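/- (CK-extension for a fixed direction) Let η ∈ 𝕊, Ω₀ ⊆ ℝ^{p+1} a domain, and f₀ : Ω₀ → ℝ_{p+q} real analytic. Then the function CK[f₀, η](𝐱) = Σ_{k=0}^{∞} ( ⟨η, 𝐱_q⟩^k / k! ) (η D_{𝐱_p})^k f₀(𝐱_p) converges in a p-symmetric slice domain Ω ⊆ Ω₀* containing Ω₀ and satisfies ∂_η CK[f₀, η] = 0 and D_𝐱 CK[f₀, η] = 0 on Ω, where ∂_η = D_{𝐱_p} + η ⟨η, D_{𝐱_q}⟩ and ⟨η, D_{𝐱_q}⟩ = Σ_{i=p+1}^{p+q} η_i ∂_{x_i} is the directional derivative along η. -/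

import Mathlib

/-!
Common framework for generalized partial-slice monogenic functions
(Xu–Sabadini, "On the Fueter-Sce theorem for generalized partial-slice
monogenic functions").

The real Clifford algebra `ℝ_{p+q}` is formalized as the Mathlib Clifford
algebra of the negative-definite quadratic form on `ℝ^{p+q}`; since Mathlib
provides no canonical norm on it, all analytic statements are phrased for an
arbitrary normed real algebra `A` together with an `ℝ`-algebra isomorphism
`ξ : A ≃ₐ[ℝ] Cl (p+q)`.  A point of `ℝ^{p+q+1}` is a pair
`(𝐱_p, 𝐱_q) : (Fin (p+1) → ℝ) × EuclideanSpace ℝ (Fin q)`, and a point of a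
slice `ℝ^{p+2}` is a pair `(𝐱_p, r)`.
-/

noncomputable section

open Filter Topology MeasureTheory Metric
open scoped Nat RealInnerProductSpace

namespace GPS

/-- The negative definite quadratic form `-(x₁² + ⋯ + xₙ²)` on `ℝⁿ`. -/
def Qe (n : ℕ) : QuadraticForm ℝ (Fin n → ℝ) :=
  QuadraticMap.weightedSumSquares ℝ (fun _ : Fin n => (-1 : ℝ))

/-- The real Clifford algebra `ℝ_n`. -/
abbrev Cl (n : ℕ) : Type := CliffordAlgebra (Qe n)

/-- The generators `e_1, …, e_n` of `ℝ_n` (indexed by `Fin n`). -/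
def e (n : ℕ) (i : Fin n) : Cl n := CliffordAlgebra.ι (Qe n) (Pi.single i 1)

variable (p q : ℕ)

/-- `ℝ^{p+1}`, the "slice-axis" space. -/
abbrev Vp : Type := Fin (p + 1) → ℝ

/-- `ℝ^q`. -/
abbrev Vq : Type := EuclideanSpace ℝ (Fin q)

/-- `ℝ^{p+q+1} = ℝ^{p+1} ⊕ ℝ^q`. -/
abbrev V : Type := Vp p × Vq q

/-- `ℝ^{p+2}`, the parameter space `(𝐱_p, r)` of a slice. -/
abbrev Sl : Type := Vp p × ℝ

/-- The sphere `𝕊` of unit 1-vectors, described by their coordinate vectors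
`(x_{p+1}, …, x_{p+q}) ∈ ℝ^q` with `∑ x_i² = 1`. -/
def S : Set (Vq q) := {v | ∑ j, v j ^ 2 = 1}

/-- The point `𝐱_p + r ω` of `ℝ^{p+q+1}`. -/
def spt (v : Vq q) (z : Sl p) : V p q := (z.1, z.2 • v)

/-- The (parameterized) slice `Ω_ω` of a set `Ω ⊆ ℝ^{p+q+1}`. -/
def sliceSet (Ω : Set (V p q)) (v : Vq q) : Set (Sl p) := {z | spt p q v z ∈ Ω}

/-- `Ω₀* = {𝐱_p + 𝐱_q : 𝐱_p ∈ Ω₀, 𝐱_q ∈ ℝ^q}`. -/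
def star0 (Ω₀ : Set (Vp p)) : Set (V p q) := {z | z.1 ∈ Ω₀}

/-- The p-symmetric completion `Ω_D` of a set `D ⊆ ℝ^{p+2}`. -/
def completion (D : Set (Sl p)) : Set (V p q) :=
  {x | ∃ z ∈ D, ∃ v ∈ S q, x = spt p q v z}

/-- `D` is invariant under the reflection of the `(p+2)`-th variable. -/
def ReflInv (D : Set (Sl p)) : Prop := ∀ z ∈ D, ((z.1, -z.2) : Sl p) ∈ D

/-- A domain: a nonempty open connected set. -/
def IsDomain {E : Type*} [TopologicalSpace E] (s : Set E) : Prop :=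
  IsOpen s ∧ IsConnected s

/-- A slice domain. -/
def IsSliceDomain (Ω : Set (V p q)) : Prop :=
  IsDomain Ω ∧ (∃ x : Vp p, ((x, 0) : V p q) ∈ Ω) ∧
    ∀ v ∈ S q, IsDomain (sliceSet p q Ω v)

/-- Partial symmetry with respect to `ℝ^{p+1}`. -/
def IsPSymmetric (Ω : Set (V p q)) : Prop :=
  ∀ (x : Vp p) (r : ℝ), ∀ v ∈ S q, ∀ w ∈ S q,
    ((x, r • v) : V p q) ∈ Ω → ((x, r • w) : V p q) ∈ Ω

/-- A `d`-dimensional smooth submanifold of a real normed space. -/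
def IsSmoothSubmanifoldDim {E : Type*} [NormedAddCommGroup E] [NormedSpace ℝ E]
    (d : ℕ) (M : Set E) : Prop :=
  ∀ x ∈ M, ∃ U : Set E, IsOpen U ∧ x ∈ U ∧
    ∃ (ψ : (Fin d → ℝ) → E) (W : Set (Fin d → ℝ)), IsOpen W ∧
      ContDiffOn ℝ (⊤ : ℕ∞) ψ W ∧ Set.InjOn ψ W ∧
      (∀ y ∈ W, Function.Injective (fderivWithin ℝ ψ W y)) ∧
      M ∩ U = ψ '' W

variable {A : Type*} [NormedRing A] [NormedAlgebra ℝ A] (ξ : A ≃ₐ[ℝ] Cl (p + q))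

/-- The generators `e_1, …, e_{p+q}` inside `A`. -/
def gen (i : Fin (p + q)) : A := ξ.symm (e (p + q) i)

/-- The generators `e_{p+1}, …, e_{p+q}` (the "q-part"). -/
def eQ (j : Fin q) : A := gen p q ξ ⟨p + (j : ℕ), by have := j.isLt; omega⟩

/-- The generators `e_1, …, e_p` (the "p-part", without `e_0 = 1`). -/
def eP (i : Fin p) : A := gen p q ξ ⟨(i : ℕ), by have := i.isLt; omega⟩

/-- `e_0 = 1, e_1, …, e_p`: the paravector basis of `ℝ^{p+1}` inside `A`. -/
def εp (i : Fin (p + 1)) : A :=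
  if h : (i : ℕ) = 0 then 1 else gen p q ξ ⟨(i : ℕ) - 1, by have := i.isLt; omega⟩

/-- The 1-vector `∑ x_i e_{p+i} ∈ A` corresponding to `𝐱_q ∈ ℝ^q`;
for a unit `v` this is the imaginary unit `ω ∈ 𝕊`. -/
def ωCl (v : Vq q) : A := ∑ j, v j • eQ p q ξ j

/-- The paravector `x_0 + x_1 e_1 + ⋯ + x_p e_p ∈ A` of `𝐱_p ∈ ℝ^{p+1}`. -/
def clP (x : Vp p) : A := ∑ i, x i • εp p q ξ i

/-- The paravector of `𝐱 ∈ ℝ^{p+q+1}` in `A`. -/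
def toCl (z : V p q) : A := clP p q ξ z.1 + ωCl p q ξ z.2

section SliceOperators

variable {F' : Type*} [NormedAddCommGroup F'] [NormedSpace ℝ F']

/-- `∂_{x_i}` on functions on `ℝ^{p+2}`. -/
def pdSl (i : Fin (p + 1)) (F : Sl p → F') : Sl p → F' :=
  fun z => fderiv ℝ F z (Pi.single i 1, 0)

/-- `∂_r` on functions on `ℝ^{p+2}`. -/
def pdr (F : Sl p → F') : Sl p → F' := fun z => fderiv ℝ F z (0, 1)

/-- `∂_{x_i}` (first factor) on functions on `ℝ^{p+q+1}`. -/
def pdV1 (i : Fin (p + 1)) (f : V p q → F') : V p q → F' :=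
  fun z => fderiv ℝ f z ((Pi.single i 1 : Vp p), 0)

/-- `∂_{x_{p+j}}` (second factor) on functions on `ℝ^{p+q+1}`. -/
def pdV2 (j : Fin q) (f : V p q → F') : V p q → F' :=
  fun z => fderiv ℝ f z (0, EuclideanSpace.single j 1)

/-- `∂_{x_i}` on functions on `ℝ^{p+1}`. -/
def pdP (i : Fin (p + 1)) (g : Vp p → F') : Vp p → F' :=
  fun x => fderiv ℝ g x (Pi.single i 1)

/-- The Laplacian `Δ_{𝐱'} = Δ_{𝐱_p} + ∂_r²` on `ℝ^{p+2}`. -/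
def LapSl (F : Sl p → F') : Sl p → F' :=
  fun z => ∑ i, pdSl p (i := i) (pdSl p i F) z + pdr p (pdr p F) z

/-- The Laplacian `Δ_𝐱` on `ℝ^{p+q+1}`. -/
def LapV (f : V p q → F') : V p q → F' :=
  fun z => ∑ i, pdV1 p q i (pdV1 p q i f) z + ∑ j, pdV2 p q j (pdV2 p q j f) z

/-- The Laplacian `Δ_{𝐱_p}` on `ℝ^{p+1}`. -/
def LapP (g : Vp p → F') : Vp p → F' :=
  fun x => ∑ i, pdP p i (pdP p i g) x

end SliceOperators

/-- The generalized Cauchy–Riemann operator `D_{𝐱_p} = ∑_{i=0}^p e_i ∂_{x_i}`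
on slice functions. -/
def DP (F : Sl p → A) : Sl p → A :=
  fun z => ∑ i, εp p q ξ i * pdSl p i F z

/-- The conjugated operator `D̄_{𝐱_p} = ∂_{x_0} - ∑_{i=1}^p e_i ∂_{x_i}`. -/
def DPbar (F : Sl p → A) : Sl p → A :=
  fun z => pdSl p 0 F z - ∑ i : Fin p, eP p q ξ i * pdSl p i.succ F z

/-- The generalized Cauchy–Riemann (Dirac) operator `D_𝐱` on `ℝ^{p+q+1}`. -/
def DV (f : V p q → A) : V p q → A :=
  fun z => ∑ i, εp p q ξ i * pdV1 p q i f z + ∑ j, eQ p q ξ j * pdV2 p q j f z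

/-- `D_{𝐱_p} = ∑_{i=0}^p e_i ∂_{x_i}` on functions on `ℝ^{p+1}`. -/
def DPfun (g : Vp p → A) : Vp p → A :=
  fun x => ∑ i, εp p q ξ i * pdP p i g x

/-- The slice operator `D_ω = D_{𝐱_p} + ω ∂_r`, expressed on `ℝ^{p+q+1} ∖ ℝ^{p+1}`
(at `𝐱_q = 0` the radial part is junk `0`). -/
def Dslice (f : V p q → A) : V p q → A :=
  fun z => ∑ i, εp p q ξ i * pdV1 p q i f z
    + ωCl p q ξ (‖z.2‖⁻¹ • z.2) * fderiv ℝ f z (0, ‖z.2‖⁻¹ • z.2)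

/-- The spherical Dirac operator `Γ = -∑_{i<j} e_i e_j L_{ij}` on the `ℝ^q` variables. -/
def sphericalDirac (f : V p q → A) : V p q → A :=
  fun z => - ∑ i : Fin q, ∑ j : Fin q,
    if (i : ℕ) < (j : ℕ) then
      eQ p q ξ i * eQ p q ξ j *
        (z.2 i • pdV2 p q j f z - z.2 j • pdV2 p q i f z)
    else 0

/-- `f` is left generalized partial-slice monogenic of type `(p,q)` on `Ω`. -/
def GSMOn (Ω : Set (V p q)) (f : V p q → A) : Prop :=
  ∀ v ∈ S q,
    ContDiffOn ℝ 1 (fun z => f (spt p q v z)) (sliceSet p q Ω v) ∧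
    ∀ z ∈ sliceSet p q Ω v,
      DP p q ξ (fun w => f (spt p q v w)) z
        + ωCl p q ξ v * pdr p (fun w => f (spt p q v w)) z = 0

/-- `f` is (left) monogenic on `Ω`. -/
def MonogenicOn (Ω : Set (V p q)) (f : V p q → A) : Prop :=
  ContDiffOn ℝ 1 f Ω ∧ ∀ z ∈ Ω, DV p q ξ f z = 0

/-- `f` is the generalized partial-slice function on `Ω_D` with components `F1, F2`
(an even–odd pair in the last variable). -/
def IsGPSlice (D : Set (Sl p)) (f : V p q → A) (F1 F2 : Sl p → A) : Prop :=
  (∀ z ∈ D, F1 (z.1, -z.2) = F1 z ∧ F2 (z.1, -z.2) = -F2 z) ∧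
  ∀ z ∈ D, ∀ v ∈ S q, f (spt p q v z) = F1 z + ωCl p q ξ v * F2 z

/-- The generalized Cauchy–Riemann system (2.6) for the pair `(F1, F2)`. -/
def CRSystem (D : Set (Sl p)) (F1 F2 : Sl p → A) : Prop :=
  ∀ z ∈ D, DP p q ξ F1 z - pdr p F2 z = 0 ∧ DPbar p q ξ F2 z + pdr p F1 z = 0

/-- `f ∈ 𝒢𝒮ℛ(Ω_D)` with the given components. -/
def GSROnWith (D : Set (Sl p)) (f : V p q → A) (F1 F2 : Sl p → A) : Prop :=
  IsGPSlice p q ξ D f F1 F2 ∧ ContDiffOn ℝ 1 F1 D ∧ ContDiffOn ℝ 1 F2 D ∧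
    CRSystem p q ξ D F1 F2

/-- `f ∈ 𝒢𝒮ℛ(Ω_D)`. -/
def GSROn (D : Set (Sl p)) (f : V p q → A) : Prop :=
  ∃ F1 F2, GSROnWith p q ξ D f F1 F2

/-- Iterates `((1/r) ∂_r)^k F`. -/
def AIter (F : Sl p → A) : ℕ → Sl p → A
  | 0 => F
  | k + 1 => fun z => z.2⁻¹ • pdr p (AIter F k) z

/-- Iterates `(∂_r (1/r))^k F`. -/
def BIter (F : Sl p → A) : ℕ → Sl p → A
  | 0 => F
  | k + 1 => fun z => fderiv ℝ (fun w : Sl p => w.2⁻¹ • BIter F k w) z (0, 1)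

/-- `C_q(k) = (q-1)(q-3)⋯(q-2k+1)`. -/
def Cq (k : ℕ) : ℝ := ∏ j ∈ Finset.range k, ((q : ℝ) - (2 * (j : ℝ) + 1))

/-- The Fueter–Sce map `τ_q = (1/(q-1)!!) Δ^{(q-1)/2}` (for odd `q`). -/
def tauq (f : V p q → A) : V p q → A :=
  fun z => (((q - 1)‼ : ℝ))⁻¹ • (LapV p q)^[(q - 1) / 2] f z

/-- `(𝐱_q D_{𝐱_p})^k`, for a fixed Clifford element `u` in place of `𝐱_q`. -/
def uDpow (u : A) : ℕ → (Vp p → A) → Vp p → A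
  | 0 => fun g => g
  | k + 1 => fun g x => u * DPfun p q ξ (uDpow u k g) x

/-- The `k`-th term of the slice Cauchy–Kovalevskaya extension series. -/
def ckTerm (f₀ : Vp p → A) (k : ℕ) (z : V p q) : A :=
  ((k ! : ℝ))⁻¹ • uDpow p q ξ (ωCl p q ξ z.2) k f₀ z.1

/-- The slice Cauchy–Kovalevskaya extension `CK[f₀]`. -/
def CKext (f₀ : Vp p → A) (z : V p q) : A := ∑' k, ckTerm p q ξ f₀ k z

/-- The `k`-th term of the CK-extension for a fixed direction `w`. -/
def ckDirTerm (w : Vq q) (f₀ : Vp p → A) (k : ℕ) (z : V p q) : A :=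
  ((⟪w, z.2⟫) ^ k / (k ! : ℝ)) • uDpow p q ξ (ωCl p q ξ w) k f₀ z.1

/-- The CK-extension for a fixed direction `w ∈ 𝕊`. -/
def CKdir (w : Vq q) (f₀ : Vp p → A) (z : V p q) : A :=
  ∑' k, ckDirTerm p q ξ w f₀ k z

/-- The coefficients of the generalized CK-extension:
`f_{2k} = (Γ(q/2) / (2^{2k} k! Γ(k+q/2))) Δ^k f₀` and
`f_{2k+1} = (Γ(q/2) / (2^{2k+1} k! Γ(k+q/2+1))) D Δ^k f₀`. -/
def gckCoeff (f₀ : Vp p → A) (k : ℕ) : Vp p → A :=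
  if k % 2 = 0 then
    fun x => (Real.Gamma ((q : ℝ) / 2) /
        (2 ^ k * ((k / 2)! : ℝ) * Real.Gamma (((k / 2 : ℕ) : ℝ) + (q : ℝ) / 2))) •
      (LapP p)^[k / 2] f₀ x
  else
    fun x => (Real.Gamma ((q : ℝ) / 2) /
        (2 ^ k * ((k / 2)! : ℝ) * Real.Gamma (((k / 2 : ℕ) : ℝ) + (q : ℝ) / 2 + 1))) •
      DPfun p q ξ ((LapP p)^[k / 2] f₀) x

/-- The `k`-th term `𝐱_q^k f_k(𝐱_p)` of the generalized CK-extension series. -/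
def gckTerm (f₀ : Vp p → A) (k : ℕ) (z : V p q) : A :=
  (ωCl p q ξ z.2) ^ k * gckCoeff p q ξ f₀ k z.1

/-- The generalized CK-extension `GCK[f₀]`. -/
def GCKext (f₀ : Vp p → A) (z : V p q) : A := ∑' k, gckTerm p q ξ f₀ k z

/-- The Radon transform `R[f](𝐱_p, r, ω) = ∫_{⟨𝐱_q,ω⟩=r} f(𝐱_p, 𝐱_q) dσ(𝐱_q)`. -/
def radon (f : V p q → A) (x : Vp p) (r : ℝ) (w : Vq q) : A :=
  ∫ u : ((Submodule.span ℝ {w})ᗮ : Submodule ℝ (Vq q)),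
    f (x, r • w + (u : Vq q))

/-- The (suitably normalized) surface measure on the unit sphere of `ℝ^q`. -/
def sphMeasure : Measure (sphere (0 : Vq q) 1) := volume.toSphere

/-- The dual Radon transform
`Ř[f](𝐱_p, 𝐱_q) = (1/A_q) ∫_𝕊 f(𝐱_p, ⟨𝐱_q, η⟩ η) dS(η)` (a spherical average). -/
def dualRadon (f : V p q → A) (z : V p q) : A :=
  ⨍ w : sphere (0 : Vq q) 1,
    f (z.1, (⟪((w : Vq q)), z.2⟫) • (w : Vq q)) ∂(sphMeasure q)

end GPS

open GPS

/-- Uniform bound on the coefficients of the re-centered power series. -/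
theorem FormalMultilinearSeries.nnnorm_changeOrigin_mul_pow_le {E F : Type*}
    [NormedAddCommGroup E] [NormedSpace ℝ E] [NormedAddCommGroup F] [NormedSpace ℝ F]
    [CompleteSpace F] (P : FormalMultilinearSeries ℝ E F) {r r' : NNReal}
    (hr : (r : ENNReal) + r' < P.radius) :
    ∃ B : NNReal, ∀ y : E, ‖y‖₊ ≤ r → ∀ k, ‖P.changeOrigin y k‖₊ * r' ^ k ≤ B := by
  have hS := P.changeOriginSeries_summable_aux₁ hr
  refine ⟨_, fun y hy k => le_trans ?_ (NNReal.tsum_comp_le_tsum_of_inj hS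
    (i := Sigma.mk k) sigma_mk_injective)⟩
  have hk := (NNReal.summable_sigma.1 hS).1 k
  have hyr : (‖y‖₊ : ENNReal) < P.radius :=
    lt_of_le_of_lt (by exact_mod_cast hy) (lt_of_le_of_lt le_self_add hr)
  refine (mul_le_mul_left (P.nnnorm_changeOrigin_le k hyr) _).trans ?_
  rw [← NNReal.tsum_mul_right]
  have hle : ∀ s : Σ l : ℕ, { s : Finset (Fin (k + l)) // s.card = l },
      ‖P (k + s.1)‖₊ * ‖y‖₊ ^ s.1 * r' ^ k ≤ ‖P (k + s.1)‖₊ * r ^ s.1 * r' ^ k :=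
    fun s => by gcongr
  exact (NNReal.summable_of_le hle hk).tsum_le_tsum hle hk

/-- Cauchy estimates for a real analytic function, uniform near a point. -/
theorem AnalyticAt.exists_norm_iteratedFDeriv_le {E F : Type*} [NormedAddCommGroup E]
    [NormedSpace ℝ E] [NormedAddCommGroup F] [NormedSpace ℝ F] [CompleteSpace F]
    {f : E → F} {x : E} (hf : AnalyticAt ℝ f x) :
    ∃ δ > 0, ∃ C > 0, ∃ M ≥ 0, ∀ y ∈ ball x δ, ∀ k : ℕ,
      ‖iteratedFDeriv ℝ k f y‖ ≤ M * C ^ k * k ! := by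
  obtain ⟨P, r, hP⟩ := hf
  obtain ⟨a, ha0, har⟩ := ENNReal.lt_iff_exists_nnreal_btwn.1 hP.r_pos
  have ha : 0 < a := by exact_mod_cast ha0
  have hsum : ((a / 2 : NNReal) : ENNReal) + (a / 2 : NNReal) < P.radius := by
    rw [← ENNReal.coe_add, add_halves]
    exact har.trans_le hP.r_le
  obtain ⟨B, key⟩ := P.nnnorm_changeOrigin_mul_pow_le hsum
  have ha2 : (0 : ℝ) < a / 2 := by positivity
  refine ⟨a / 2, ha2, (a / 2 : ℝ)⁻¹, by positivity, B, B.2, fun y hy k => ?_⟩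
  have hyn : ‖y - x‖₊ ≤ a / 2 := by
    rw [← NNReal.coe_le_coe]
    simpa [← dist_eq_norm] using (mem_ball.1 hy).le
  have hyr : (‖y - x‖₊ : ENNReal) < r := by
    refine lt_of_le_of_lt ?_ har
    exact_mod_cast hyn.trans (half_le_self a.2)
  have hco := hP.changeOrigin hyr
  rw [add_sub_cancel] at hco
  have hb : ‖P.changeOrigin (y - x) k‖ ≤ B * (a / 2 : ℝ)⁻¹ ^ k := by
    rw [inv_pow, ← div_eq_mul_inv, le_div_iff₀ (by positivity)]
    exact_mod_cast key _ hyn k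
  refine ContinuousMultilinearMap.opNorm_le_bound (by positivity) fun v => ?_
  rw [hco.iteratedFDeriv_eq_sum_of_completeSpace]
  calc ‖∑ σ : Equiv.Perm (Fin k), P.changeOrigin (y - x) k fun i => v (σ i)‖
      ≤ ∑ σ : Equiv.Perm (Fin k), B * (a / 2 : ℝ)⁻¹ ^ k * ∏ i, ‖v i‖ := by
        refine norm_sum_le_of_le _ fun σ _ => ?_
        rw [← Equiv.prod_comp σ fun i => ‖v i‖]
        exact (ContinuousMultilinearMap.le_opNorm _ _).trans (by gcongr)
    _ = B * (a / 2 : ℝ)⁻¹ ^ k * k ! * ∏ i, ‖v i‖ := by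
        rw [Finset.sum_const, Finset.card_univ, Fintype.card_perm, Fintype.card_fin, nsmul_eq_mul]
        ring

section PowerSeries

variable {E E' F : Type*} [NormedAddCommGroup E] [NormedSpace ℝ E] [NormedAddCommGroup E']
  [NormedSpace ℝ E'] [NormedAddCommGroup F] [NormedSpace ℝ F]

/-- The derivative of `(x, y) ↦ (ℓ y ^ k / k!) • g x`. -/
def powSMulFDeriv (ℓ : E' →L[ℝ] ℝ) (k : ℕ) (g : E → F) (z : E × E') : E × E' →L[ℝ] F :=
  (ℓ z.2 ^ k / (k ! : ℝ)) • (fderiv ℝ g z.1).comp (ContinuousLinearMap.fst ℝ E E') +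
    ((k * ℓ z.2 ^ (k - 1) / (k ! : ℝ)) • ℓ.comp (ContinuousLinearMap.snd ℝ E E')).smulRight (g z.1)

theorem hasFDerivAt_powSMul (ℓ : E' →L[ℝ] ℝ) (k : ℕ) {g : E → F} {z : E × E'}
    (hg : DifferentiableAt ℝ g z.1) :
    HasFDerivAt (fun z : E × E' => (ℓ z.2 ^ k / (k ! : ℝ)) • g z.1)
      (powSMulFDeriv ℓ k g z) z := by
  have h1 : HasFDerivAt (fun z : E × E' => ℓ z.2) (ℓ.comp (ContinuousLinearMap.snd ℝ E E')) z :=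
    (ℓ.comp (ContinuousLinearMap.snd ℝ E E')).hasFDerivAt
  have h2 := (h1.pow k).mul_const ((k ! : ℝ)⁻¹)
  have h3 := hg.hasFDerivAt.comp z (hasFDerivAt_fst (𝕜 := ℝ) (E := E) (F := E'))
  have h4 := h2.smul h3
  refine h4.congr_fderiv ?_
  ext v <;> simp [powSMulFDeriv, smul_smul, div_eq_mul_inv]
  congr 1
  ring

theorem norm_powSMulFDeriv_le {ℓ : E' →L[ℝ] ℝ} (hℓ : ‖ℓ‖ ≤ 1) {k : ℕ} {g : E → F}
    {z : E × E'} {B R τ : ℝ} (hB : 0 ≤ B) (hR : 0 ≤ R) (hτ : 0 < τ) (hz : ‖z.2‖ ≤ τ)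
    (h0 : ‖g z.1‖ ≤ B * R ^ k * k !) (h1 : ‖fderiv ℝ g z.1‖ ≤ B * R ^ k * (k + 1)!) :
    ‖powSMulFDeriv ℓ k g z‖ ≤ B * (1 + τ⁻¹) * ((k + 1) * (R * τ) ^ k) := by
  have ht : |ℓ z.2| ≤ τ := by
    refine (ℓ.le_of_opNorm_le hℓ z.2).trans ?_
    simpa using hz
  have hk : (0 : ℝ) < k ! := by positivity
  have n1 : ‖(ℓ z.2 ^ k / (k ! : ℝ)) •
      (fderiv ℝ g z.1).comp (ContinuousLinearMap.fst ℝ E E')‖ ≤ B * ((k + 1) * (R * τ) ^ k) := by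
    rw [norm_smul, norm_div, norm_pow, Real.norm_eq_abs, Real.norm_of_nonneg hk.le]
    have : ‖(fderiv ℝ g z.1).comp (ContinuousLinearMap.fst ℝ E E')‖ ≤ B * R ^ k * (k + 1)! := by
      refine (ContinuousLinearMap.opNorm_comp_le _ _).trans ?_
      refine (mul_le_of_le_one_right (norm_nonneg _) (ContinuousLinearMap.norm_fst_le ..)).trans h1
    calc |ℓ z.2| ^ k / k ! * ‖(fderiv ℝ g z.1).comp (ContinuousLinearMap.fst ℝ E E')‖
        ≤ τ ^ k / k ! * (B * R ^ k * (k + 1)!) := by gcongr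
      _ = B * ((k + 1) * (R * τ) ^ k) := by
        rw [Nat.factorial_succ, mul_pow]; push_cast; field_simp
  have n2 : ‖((k * ℓ z.2 ^ (k - 1) / (k ! : ℝ)) •
      ℓ.comp (ContinuousLinearMap.snd ℝ E E')).smulRight (g z.1)‖
      ≤ B * τ⁻¹ * ((k + 1) * (R * τ) ^ k) := by
    rw [ContinuousLinearMap.norm_smulRight_apply, norm_smul, norm_div, norm_mul, norm_pow,
      Real.norm_natCast, Real.norm_eq_abs, Real.norm_of_nonneg hk.le]
    have : ‖ℓ.comp (ContinuousLinearMap.snd ℝ E E')‖ ≤ 1 :=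
      (ContinuousLinearMap.opNorm_comp_le _ _).trans
        (mul_le_one₀ hℓ (norm_nonneg _) (ContinuousLinearMap.norm_snd_le ..))
    have hpow : (k : ℝ) * τ ^ (k - 1) ≤ (k + 1) * (τ ^ k * τ⁻¹) := by
      cases k with
      | zero => simp; positivity
      | succ n =>
        have : τ ^ (n + 1) * τ⁻¹ = τ ^ n := by rw [pow_succ, mul_inv_cancel_right₀ hτ.ne']
        rw [this]
        simp only [Nat.add_sub_cancel]
        gcongr
        linarith
    calc (k * |ℓ z.2| ^ (k - 1) / k ! * ‖ℓ.comp (ContinuousLinearMap.snd ℝ E E')‖) * ‖g z.1‖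
        ≤ (k * τ ^ (k - 1) / k ! * 1) * (B * R ^ k * k !) := by gcongr
      _ = (k * τ ^ (k - 1)) * (B * R ^ k) := by field_simp
      _ ≤ ((k + 1) * (τ ^ k * τ⁻¹)) * (B * R ^ k) := by gcongr
      _ = B * τ⁻¹ * ((k + 1) * (R * τ) ^ k) := by rw [mul_pow]; ring
  calc ‖powSMulFDeriv ℓ k g z‖ ≤ _ := norm_add_le_of_le n1 n2
    _ = _ := by ring

/-- Term by term differentiation of `∑ₖ (ℓ y ^ k / k!) • gₖ x`, for coefficients `gₖ` of
factorial growth. -/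
theorem hasFDerivAt_tsum_powSMul [CompleteSpace F] {ℓ : E' →L[ℝ] ℝ} (hℓ : ‖ℓ‖ ≤ 1)
    {g : ℕ → E → F} {x₀ : E} {B R δ : ℝ} (hB : 0 ≤ B) (hR : 0 ≤ R) (hδ : 0 < δ) (hRδ : R * δ < 1)
    (hg : ∀ k, ∀ x ∈ ball x₀ δ, DifferentiableAt ℝ (g k) x)
    (h0 : ∀ k, ∀ x ∈ ball x₀ δ, ‖g k x‖ ≤ B * R ^ k * k !)
    (h1 : ∀ k, ∀ x ∈ ball x₀ δ, ‖fderiv ℝ (g k) x‖ ≤ B * R ^ k * (k + 1)!)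
    {z : E × E'} (hz : z ∈ ball ((x₀, 0) : E × E') δ) :
    Summable (fun k => (ℓ z.2 ^ k / (k ! : ℝ)) • g k z.1) ∧
    Summable (fun k => powSMulFDeriv ℓ k (g k) z) ∧
    HasFDerivAt (fun z : E × E' => ∑' k, (ℓ z.2 ^ k / (k ! : ℝ)) • g k z.1)
      (∑' k, powSMulFDeriv ℓ k (g k) z) z := by
  have hmem : ∀ z ∈ ball ((x₀, 0) : E × E') δ, z.1 ∈ ball x₀ δ ∧ ‖z.2‖ ≤ δ := by
    intro z hz
    rw [← ball_prod_same] at hz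
    exact ⟨hz.1, (mem_ball_zero_iff.1 hz.2).le⟩
  have hu : Summable fun k : ℕ => B * (1 + δ⁻¹) * ((k + 1) * (R * δ) ^ k) := by
    have hn : ‖R * δ‖ < 1 := by rwa [Real.norm_of_nonneg (by positivity)]
    refine Summable.mul_left _ ?_
    have := (summable_pow_mul_geometric_of_norm_lt_one 1 hn).add
      (summable_geometric_of_norm_lt_one hn)
    refine this.congr fun k => ?_
    ring
  have hd : ∀ k, ∀ z ∈ ball ((x₀, 0) : E × E') δ,
      HasFDerivAt (fun z : E × E' => (ℓ z.2 ^ k / (k ! : ℝ)) • g k z.1)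
        (powSMulFDeriv ℓ k (g k) z) z :=
    fun k z hz => hasFDerivAt_powSMul ℓ k (hg k _ (hmem z hz).1)
  have hb : ∀ k, ∀ z ∈ ball ((x₀, 0) : E × E') δ,
      ‖powSMulFDeriv ℓ k (g k) z‖ ≤ B * (1 + δ⁻¹) * ((k + 1) * (R * δ) ^ k) :=
    fun k z hz => norm_powSMulFDeriv_le hℓ hB hR hδ (hmem z hz).2
      (h0 k _ (hmem z hz).1) (h1 k _ (hmem z hz).1)
  have hc : Summable fun k : ℕ => (ℓ ((x₀, 0) : E × E').2 ^ k / (k ! : ℝ)) •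
      g k ((x₀, 0) : E × E').1 := by
    refine summable_of_ne_finset_zero (s := {0}) fun k hk => ?_
    have : k ≠ 0 := by simpa using hk
    simp [this]
  have hpre := (convex_ball ((x₀, 0) : E × E') δ).isPreconnected
  have hx₀ := mem_ball_self (x := ((x₀, 0) : E × E')) hδ
  exact ⟨summable_of_summable_hasFDerivAt_of_isPreconnected hu isOpen_ball hpre hd hb hx₀ hc hz,
    Summable.of_norm_bounded hu fun k => hb k z hz,
    hasFDerivAt_tsum_of_isPreconnected hu isOpen_ball hpre hd hb hx₀ hc hz⟩

/-- The union of the balls `B((x, 0), δ x)` over a domain of points `x` is a domain. -/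
theorem isDomain_iUnion_ball {Ω₀ : Set E} (hΩ₀ : IsDomain Ω₀) {δ : E → ℝ}
    (hδ : ∀ x ∈ Ω₀, 0 < δ x) :
    IsDomain (⋃ x ∈ Ω₀, ball ((x, 0) : E × E') (δ x)) := by
  refine ⟨isOpen_biUnion fun x _ => isOpen_ball, ?_, ?_⟩
  · obtain ⟨x, hx⟩ := hΩ₀.2.nonempty
    exact ⟨(x, 0), Set.mem_biUnion hx (mem_ball_self (hδ x hx))⟩
  obtain ⟨a, ha⟩ := hΩ₀.2.nonempty
  have haxis : IsPreconnected ((fun x : E => ((x, 0) : E × E')) '' Ω₀) :=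
    hΩ₀.2.isPreconnected.image _ (by fun_prop)
  refine isPreconnected_of_forall (a, 0) fun z hz => ?_
  obtain ⟨x, hx, hzx⟩ := Set.mem_iUnion₂.1 hz
  refine ⟨(fun x : E => ((x, 0) : E × E')) '' Ω₀ ∪ ball (x, 0) (δ x), ?_,
    Or.inl ⟨a, ha, rfl⟩, Or.inr hzx, ?_⟩
  · rintro _ (⟨y, hy, rfl⟩ | hy)
    · exact Set.mem_biUnion hy (mem_ball_self (hδ y hy))
    · exact Set.mem_biUnion hx hy
  · exact haxis.union (x, 0) ⟨x, hx, rfl⟩ (mem_ball_self (hδ x hx))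
      (convex_ball _ _).isPreconnected

end PowerSeries

section Clifford

theorem finiteDimensional_Cl (n : ℕ) : FiniteDimensional ℝ (Cl n) := by
  have : FiniteDimensional ℝ (ExteriorAlgebra ℝ (Fin n → ℝ)) :=
    Module.Finite.of_basis (Pi.basisFun ℝ (Fin n)).ExteriorAlgebra
  exact Module.Finite.equiv (CliffordAlgebra.equivExterior (Qe n)).symm

variable {p q : ℕ} {A : Type*} [NormedRing A] [NormedAlgebra ℝ A] (ξ : A ≃ₐ[ℝ] Cl (p + q))

theorem ωCl_mul_self {v : Vq q} (hv : v ∈ S q) : ωCl p q ξ v * ωCl p q ξ v = -1 := by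
  have h : ωCl p q ξ v = ξ.symm (CliffordAlgebra.ι (Qe (p + q))
      (∑ j, v j • Pi.single (Fin.natAdd p j) (1 : ℝ))) := by
    simp only [ωCl, eQ, gen, e, map_sum, map_smul]
    rfl
  have hQ : Qe (p + q) (∑ j, v j • Pi.single (Fin.natAdd p j) (1 : ℝ)) = -1 := by
    have hv' : ∑ j, v j ^ 2 = 1 := hv
    have hc : ∀ i, (∑ j, v j • (Pi.single (Fin.natAdd p j) (1 : ℝ) : Fin (p + q) → ℝ)) i =
        Fin.addCases (fun _ => 0) (fun j => v j) i := by
      intro i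
      refine Fin.addCases (fun i => ?_) (fun i => ?_) i
      · have hne : ∀ j : Fin q, Fin.castAdd q i ≠ Fin.natAdd p j := fun j h => by
          have := congrArg Fin.val h
          have := i.isLt
          simp only [Fin.val_castAdd, Fin.val_natAdd] at *
          omega
        simp [Finset.sum_apply, hne]
      · simp [Finset.sum_apply, Pi.single_apply]
    rw [Qe, QuadraticMap.weightedSumSquares_apply]
    simp only [hc, Fin.sum_univ_add, Fin.addCases_left, Fin.addCases_right]
    simp [← sq, hv']
  rw [h, ← map_mul, CliffordAlgebra.ι_sq_scalar, hQ]
  simp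

/-- The operator `L ↦ u * ∑ e_i L(e_i)`, so that `u D_{𝐱_p} g = diracSymbol u (dg)`. -/
def diracSymbol (u : A) : (Vp p →L[ℝ] A) →L[ℝ] A :=
  ∑ i, (ContinuousLinearMap.mul ℝ A (u * εp p q ξ i)).comp
    (ContinuousLinearMap.apply ℝ A (Pi.single i 1 : Vp p))

theorem mul_DPfun (u : A) (g : Vp p → A) :
    (fun x => u * DPfun p q ξ g x) = diracSymbol ξ u ∘ fderiv ℝ g := by
  funext x
  simp [diracSymbol, DPfun, pdP, Finset.mul_sum, mul_assoc]

theorem analyticOnNhd_uDpow [CompleteSpace A] (u : A) {s : Set (Vp p)} {f : Vp p → A}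
    (hf : AnalyticOnNhd ℝ f s) (k : ℕ) : AnalyticOnNhd ℝ (uDpow p q ξ u k f) s := by
  induction k with
  | zero => exact hf
  | succ k ih =>
    change AnalyticOnNhd ℝ (fun x => u * DPfun p q ξ (uDpow p q ξ u k f) x) s
    rw [mul_DPfun]
    exact (diracSymbol ξ u).comp_analyticOnNhd ih.fderiv

theorem norm_iteratedFDeriv_uDpow_le [CompleteSpace A] (u : A) {f : Vp p → A} {x : Vp p}
    (hf : AnalyticAt ℝ f x) (k m : ℕ) :
    ‖iteratedFDeriv ℝ m (uDpow p q ξ u k f) x‖ ≤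
      ‖diracSymbol ξ u‖ ^ k * ‖iteratedFDeriv ℝ (m + k) f x‖ := by
  induction k generalizing m with
  | zero => simp [uDpow]
  | succ k ih =>
    have ha : AnalyticAt ℝ (uDpow p q ξ u k f) x :=
      analyticOnNhd_uDpow ξ u (s := {x}) (by simpa [AnalyticOnNhd] using hf) k x rfl
    change ‖iteratedFDeriv ℝ m (fun x => u * DPfun p q ξ (uDpow p q ξ u k f) x) x‖ ≤ _
    rw [mul_DPfun]
    refine ((diracSymbol ξ u).norm_iteratedFDeriv_comp_left (N := m)
      ha.fderiv.contDiffAt le_rfl).trans ?_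
    rw [norm_iteratedFDeriv_fderiv, pow_succ', mul_assoc, show m + (k + 1) = m + 1 + k by ring]
    gcongr
    exact ih (m + 1)

/-- The coefficient functions of the CK-extension grow at most factorially near each point. -/
theorem exists_norm_uDpow_le [CompleteSpace A] (u : A) {f : Vp p → A} {x₀ : Vp p}
    (hf : AnalyticAt ℝ f x₀) :
    ∃ δ > 0, ∃ B ≥ 0, ∃ R ≥ 0, ∀ x ∈ ball x₀ δ, ∀ k : ℕ,
      ‖uDpow p q ξ u k f x‖ ≤ B * R ^ k * k ! ∧
      ‖fderiv ℝ (uDpow p q ξ u k f) x‖ ≤ B * R ^ k * (k + 1)! := by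
  obtain ⟨δ₁, hδ₁, C, hC, M, hM, hbound⟩ := hf.exists_norm_iteratedFDeriv_le
  obtain ⟨δ₂, hδ₂, han⟩ := Metric.eventually_nhds_iff_ball.1 hf.eventually_analyticAt
  refine ⟨min δ₁ δ₂, lt_min hδ₁ hδ₂, M * (1 + C), by positivity, ‖diracSymbol ξ u‖ * C,
    by positivity, fun x hx k => ?_⟩
  have hx1 := hbound x (ball_subset_ball (min_le_left _ _) hx)
  have hx2 := han x (ball_subset_ball (min_le_right _ _) hx)
  have b0 := norm_iteratedFDeriv_uDpow_le ξ u hx2 k 0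
  have b1 := norm_iteratedFDeriv_uDpow_le ξ u hx2 k 1
  rw [norm_iteratedFDeriv_zero, zero_add] at b0
  rw [norm_iteratedFDeriv_one, add_comm 1 k] at b1
  constructor
  · calc _ ≤ ‖diracSymbol ξ u‖ ^ k * (M * C ^ k * k !) := b0.trans (by gcongr; exact hx1 k)
      _ = M * 1 * (‖diracSymbol ξ u‖ * C) ^ k * k ! := by rw [mul_pow]; ring
      _ ≤ _ := by gcongr; linarith
  · calc _ ≤ ‖diracSymbol ξ u‖ ^ k * (M * C ^ (k + 1) * (k + 1)!) :=
          b1.trans (by gcongr; exact hx1 (k + 1))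
      _ = M * C * (‖diracSymbol ξ u‖ * C) ^ k * (k + 1)! := by rw [mul_pow]; ring
      _ ≤ _ := by gcongr; linarith

theorem norm_eq_one_of_mem_S {v : Vq q} (hv : v ∈ S q) : ‖v‖ = 1 := by
  have hv' : ∑ j, v j ^ 2 = 1 := hv
  simp [EuclideanSpace.norm_eq, hv']

/-- Near an analyticity point of `f`, the series of the CK-extension converges and can be
differentiated term by term. -/
theorem exists_hasFDerivAt_CKdir [CompleteSpace A] {w : Vq q} (hw : w ∈ S q) {f : Vp p → A}
    {x₀ : Vp p} (hf : AnalyticAt ℝ f x₀) :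
    ∃ δ > 0, ∀ z ∈ ball ((x₀, 0) : V p q) δ,
      Summable (fun k => ckDirTerm p q ξ w f k z) ∧
      Summable (fun k => powSMulFDeriv (innerSL ℝ w) k (uDpow p q ξ (ωCl p q ξ w) k f) z) ∧
      HasFDerivAt (CKdir p q ξ w f)
        (∑' k, powSMulFDeriv (innerSL ℝ w) k (uDpow p q ξ (ωCl p q ξ w) k f) z) z := by
  obtain ⟨δ₁, hδ₁, B, hB, R, hR, hbound⟩ := exists_norm_uDpow_le ξ (ωCl p q ξ w) hf
  obtain ⟨δ₂, hδ₂, han⟩ := Metric.eventually_nhds_iff_ball.1 hf.eventually_analyticAt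
  set δ := min (min δ₁ δ₂) (R + 1)⁻¹ with hδdef
  have hδ : 0 < δ := by positivity
  have hsub1 : ball x₀ δ ⊆ ball x₀ δ₁ :=
    ball_subset_ball ((min_le_left _ _).trans (min_le_left _ _))
  have hsub2 : ball x₀ δ ⊆ ball x₀ δ₂ :=
    ball_subset_ball ((min_le_left _ _).trans (min_le_right _ _))
  have hRδ : R * δ < 1 :=
    calc R * δ ≤ R * (R + 1)⁻¹ := by gcongr; exact min_le_right _ _
      _ < 1 := by rw [← div_eq_mul_inv, div_lt_one (by positivity)]; linarith
  refine ⟨δ, hδ, fun z hz => ?_⟩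
  exact hasFDerivAt_tsum_powSMul (ℓ := innerSL ℝ w)
    (by rw [innerSL_apply_norm, norm_eq_one_of_mem_S hw]) hB hR hδ hRδ
    (fun k x hx => (analyticOnNhd_uDpow ξ _ (s := ball x₀ δ₂) han k x
      (hsub2 hx)).differentiableAt)
    (fun k x hx => (hbound x (hsub1 hx) k).1) (fun k x hx => (hbound x (hsub1 hx) k).2) hz

/-- The differential equation satisfied by the CK-extension. -/
theorem sum_pdV1_CKdir_eq {w : Vq q} (hw : w ∈ S q) {f : Vp p → A} {z : V p q}
    (hs : Summable fun k => powSMulFDeriv (innerSL ℝ w) k (uDpow p q ξ (ωCl p q ξ w) k f) z)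
    (hd : HasFDerivAt (CKdir p q ξ w f)
        (∑' k, powSMulFDeriv (innerSL ℝ w) k (uDpow p q ξ (ωCl p q ξ w) k f) z) z) :
    (∑ i, εp p q ξ i * pdV1 p q i (CKdir p q ξ w f) z
        + ωCl p q ξ w * fderiv ℝ (CKdir p q ξ w f) z (0, w)) = 0 := by
  set u := ωCl p q ξ w
  set c : ℕ → ℝ := fun k => ⟪w, z.2⟫ ^ k / (k ! : ℝ) with hc
  have happ : ∀ h : V p q, HasSum
      (fun k => powSMulFDeriv (innerSL ℝ w) k (uDpow p q ξ u k f) z h)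
      (fderiv ℝ (CKdir p q ξ w f) z h) := by
    intro h
    rw [hd.fderiv]
    exact hs.hasSum.mapL (ContinuousLinearMap.apply ℝ A h)
  have hP : HasSum (fun k => c k • DPfun p q ξ (uDpow p q ξ u k f) z.1)
      (∑ i, εp p q ξ i * pdV1 p q i (CKdir p q ξ w f) z) := by
    have := hasSum_sum (s := Finset.univ) fun i _ =>
      (happ ((Pi.single i 1 : Vp p), 0)).mul_left (εp p q ξ i)
    refine this.congr_fun fun k => ?_
    simp [powSMulFDeriv, DPfun, pdP, Finset.smul_sum, hc]
  have hQ : HasSum (fun k => u * (c k • DPfun p q ξ (uDpow p q ξ u k f) z.1))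
      (fderiv ℝ (CKdir p q ξ w f) z (0, w)) := by
    have h1 := (hasSum_nat_add_iff' 1).2 (happ (0, w))
    have hzero : powSMulFDeriv (innerSL ℝ w) 0 (uDpow p q ξ u 0 f) z (0, w) = 0 := by
      simp [powSMulFDeriv]
    rw [Finset.sum_range_one, hzero, sub_zero] at h1
    refine h1.congr_fun fun k => ?_
    have hk : (k ! : ℝ) ≠ 0 := by positivity
    have hck : ((k : ℝ) + 1) * ⟪w, z.2⟫ ^ k / ((k + 1) * k !) = c k := by
      simp only [hc]
      field_simp
    simp [powSMulFDeriv, uDpow, norm_eq_one_of_mem_S hw, Nat.factorial_succ, hck]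
  have hE := hQ.unique (hP.mul_left u)
  rw [hE, ← mul_assoc, ωCl_mul_self ξ hw]
  simp

/-- The CK-extension depends on `𝐱_q` only through `⟨w, 𝐱_q⟩`, so that `D_{𝐱_q}` acts on it as
`w ⟨w, D_{𝐱_q}⟩`. -/
theorem sum_eQ_mul_pdV2_CKdir {w : Vq q} (hw : w ∈ S q) {f : Vp p → A} {z : V p q}
    (hs : Summable fun k => powSMulFDeriv (innerSL ℝ w) k (uDpow p q ξ (ωCl p q ξ w) k f) z)
    (hd : HasFDerivAt (CKdir p q ξ w f)
        (∑' k, powSMulFDeriv (innerSL ℝ w) k (uDpow p q ξ (ωCl p q ξ w) k f) z) z) :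
    ∑ j, eQ p q ξ j * pdV2 p q j (CKdir p q ξ w f) z =
      ωCl p q ξ w * fderiv ℝ (CKdir p q ξ w f) z (0, w) := by
  have happ : ∀ h : V p q, HasSum
      (fun k => powSMulFDeriv (innerSL ℝ w) k (uDpow p q ξ (ωCl p q ξ w) k f) z h)
      (fderiv ℝ (CKdir p q ξ w f) z h) := by
    intro h
    rw [hd.fderiv]
    exact hs.hasSum.mapL (ContinuousLinearMap.apply ℝ A h)
  have hdir : ∀ h : Vq q, fderiv ℝ (CKdir p q ξ w f) z (0, h) =
      ⟪w, h⟫ • fderiv ℝ (CKdir p q ξ w f) z (0, w) := by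
    intro h
    refine (happ (0, h)).unique ?_
    convert (happ (0, w)).const_smul ⟪w, h⟫ using 2 with k
    simp [powSMulFDeriv, norm_eq_one_of_mem_S hw, smul_smul, mul_comm]
  simp only [pdV2, hdir (EuclideanSpace.single _ 1), ωCl, Finset.sum_mul]
  refine Finset.sum_congr rfl fun j _ => ?_
  simp [EuclideanSpace.inner_single_right]

end Clifford

/-- **CK-extension for a fixed direction** (Definition 5.2 and Lemma 5.3).  For `η ∈ 𝕊`
and a real analytic `f₀ : Ω₀ → ℝ_{p+q}` on a domain `Ω₀ ⊆ ℝ^{p+1}`, the series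
`CK[f₀, η](𝐱) = ∑_k (⟨η,𝐱_q⟩^k/k!) (η D_{𝐱_p})^k f₀(𝐱_p)` converges in a p-symmetric
slice domain `Ω ⊆ Ω₀*` containing `Ω₀` and satisfies `∂_η CK[f₀, η] = 0` and
`D_𝐱 CK[f₀, η] = 0` on `Ω`, where `∂_η = D_{𝐱_p} + η⟨η, D_{𝐱_q}⟩`. -/
theorem CK_fixed_direction
    (p q : ℕ) (hq : 1 ≤ q) {A : Type*} [NormedRing A] [NormedAlgebra ℝ A]
    (ξ : A ≃ₐ[ℝ] Cl (p + q))
    (w : Vq q) (hw : w ∈ S q)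
    (Ω₀ : Set (Vp p)) (hΩ₀ : IsDomain Ω₀)
    (f₀ : Vp p → A) (hf₀ : AnalyticOnNhd ℝ f₀ Ω₀) :
    ∃ Ω : Set (V p q), IsPSymmetric p q Ω ∧ IsSliceDomain p q Ω ∧
      Ω ⊆ star0 p q Ω₀ ∧ (∀ x ∈ Ω₀, ((x, 0) : V p q) ∈ Ω) ∧
      (∀ z ∈ Ω, HasSum (fun k => ckDirTerm p q ξ w f₀ k z) (CKdir p q ξ w f₀ z)) ∧
      ∀ z ∈ Ω,
        (∑ i, εp p q ξ i * pdV1 p q i (CKdir p q ξ w f₀) z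
            + ωCl p q ξ w * fderiv ℝ (CKdir p q ξ w f₀) z (0, w)) = 0 ∧
        DV p q ξ (CKdir p q ξ w f₀) z = 0 := by
  have : FiniteDimensional ℝ (Cl (p + q)) := finiteDimensional_Cl (p + q)
  have : FiniteDimensional ℝ A := Module.Finite.equiv ξ.symm.toLinearEquiv
  have : CompleteSpace A := FiniteDimensional.complete ℝ A
  have hloc : ∀ x : Vp p, ∃ δ : ℝ, x ∈ Ω₀ → 0 < δ ∧ ball x δ ⊆ Ω₀ ∧
      ∀ z ∈ ball ((x, 0) : V p q) δ, Summable (fun k => ckDirTerm p q ξ w f₀ k z) ∧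
        Summable (fun k => powSMulFDeriv (innerSL ℝ w) k (uDpow p q ξ (ωCl p q ξ w) k f₀) z) ∧
        HasFDerivAt (CKdir p q ξ w f₀)
          (∑' k, powSMulFDeriv (innerSL ℝ w) k (uDpow p q ξ (ωCl p q ξ w) k f₀) z) z := by
    intro x
    by_cases hx : x ∈ Ω₀
    · obtain ⟨δ₁, hδ₁, h₁⟩ := exists_hasFDerivAt_CKdir ξ hw (hf₀ x hx)
      obtain ⟨δ₂, hδ₂, h₂⟩ := Metric.isOpen_iff.1 hΩ₀.1 x hx
      exact ⟨min δ₁ δ₂, fun _ => ⟨lt_min hδ₁ hδ₂,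
        (ball_subset_ball (min_le_right _ _)).trans h₂,
        fun z hz => h₁ z (ball_subset_ball (min_le_left _ _) hz)⟩⟩
    · exact ⟨0, fun h => absurd h hx⟩
  choose δ hδ using hloc
  have hpos : ∀ x ∈ Ω₀, 0 < δ x := fun x hx => (hδ x hx).1
  have hmem : ∀ {E : Type} [NormedAddCommGroup E] (z : Vp p × E),
      z ∈ (⋃ x ∈ Ω₀, ball ((x, 0) : Vp p × E) (δ x)) ↔
        ∃ x ∈ Ω₀, z.1 ∈ ball x (δ x) ∧ ‖z.2‖ < δ x := by
    intro E _ z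
    simp only [Set.mem_iUnion₂, ← ball_prod_same, Set.mem_prod, mem_ball_zero_iff, exists_prop]
  have hslice : ∀ v ∈ S q, ∀ z : Sl p,
      spt p q v z ∈ (⋃ x ∈ Ω₀, ball ((x, 0) : V p q) (δ x)) ↔
        z ∈ (⋃ x ∈ Ω₀, ball ((x, 0) : Sl p) (δ x)) := by
    intro v hv z
    simp only [hmem, spt, norm_smul, norm_eq_one_of_mem_S hv, mul_one]
  have haxis : ∀ x ∈ Ω₀, ((x, 0) : V p q) ∈ (⋃ x ∈ Ω₀, ball ((x, 0) : V p q) (δ x)) :=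
    fun x hx => Set.mem_biUnion hx (mem_ball_self (hpos x hx))
  refine ⟨⋃ x ∈ Ω₀, ball ((x, 0) : V p q) (δ x), ?_, ⟨isDomain_iUnion_ball hΩ₀ hpos, ?_, ?_⟩, ?_,
    haxis, ?_, ?_⟩
  · intro x r v hv v' hv' h
    exact (hslice v' hv' (x, r)).2 ((hslice v hv (x, r)).1 h)
  · obtain ⟨x, hx⟩ := hΩ₀.2.nonempty
    exact ⟨x, haxis x hx⟩
  · intro v hv
    have : sliceSet p q (⋃ x ∈ Ω₀, ball ((x, 0) : V p q) (δ x)) v =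
        ⋃ x ∈ Ω₀, ball ((x, 0) : Sl p) (δ x) := Set.ext (hslice v hv)
    rw [this]
    exact isDomain_iUnion_ball hΩ₀ hpos
  · intro z hz
    obtain ⟨x, hx, hzx, -⟩ := (hmem z).1 hz
    exact (hδ x hx).2.1 hzx
  · intro z hz
    obtain ⟨x, hx, hzx⟩ := Set.mem_iUnion₂.1 hz
    exact ((hδ x hx).2.2 z hzx).1.hasSum
  · intro z hz
    obtain ⟨x, hx, hzx⟩ := Set.mem_iUnion₂.1 hz
    obtain ⟨-, hs, hd⟩ := (hδ x hx).2.2 z hzx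
    have hrad := sum_pdV1_CKdir_eq ξ hw hs hd
    exact ⟨hrad, by rw [DV, sum_eQ_mul_pdV2_CKdir ξ hw hs hd, hrad]⟩
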